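/- Let (Y,d) be a compact metric space and let R ⊆ Y be a dense subset with the property that for all x, y ∈ R and every ε > 0 there exists a continuous path γ : [0,1] → Y with γ(0) = x, γ(1) = y whose length is at most d(x,y) + ε. Then (Y,d) is a geodesic metric space: for any y₁, y₂ ∈ Y there exists a continuous map γ : [0, d(y₁,y₂)] → Y with γ(0) = y₁, γ(d(y₁,y₂)) = y₂ and d(γ(s), γ(t)) = |s − t| for all s, t ∈ [0, d(y₁,y₂)]. -/

import Mathlib

/-- In a compact space, a dense set whose points are joined by almost length-minimizing paths
yields, between any two points, a point dividing their distance as prescribed. -/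
theorem exists_dist_eq_of_dense_of_paths
    {Y : Type*} [MetricSpace Y] [CompactSpace Y] {R : Set Y} (hR : Dense R)
    (h : ∀ x ∈ R, ∀ y ∈ R, ∀ ε : ℝ, 0 < ε →
      ∃ γ : ℝ → Y, ContinuousOn γ (Set.Icc 0 1) ∧ γ 0 = x ∧ γ 1 = y ∧
        eVariationOn γ (Set.Icc 0 1) ≤ ENNReal.ofReal (dist x y + ε))
    (x y : Y) {r : ℝ} (hr0 : 0 ≤ r) (hr : r ≤ dist x y) :
    ∃ z, dist x z = r ∧ dist z y = dist x y - r := by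
  have approx : ∀ ε : ℝ, 0 < ε → ∃ z, dist x z ≤ r + ε ∧ dist z y ≤ dist x y - r + 6 * ε := by
    intro ε hε
    obtain ⟨x', hx', hxx'⟩ := hR.exists_dist_lt x hε
    obtain ⟨y', hy', hyy'⟩ := hR.exists_dist_lt y hε
    obtain ⟨γ, hγ, rfl, rfl, hlen⟩ := h x' hx' y' hy' ε hε
    have hcont : ContinuousOn (fun t => dist (γ 0) (γ t)) (Set.Icc 0 1) :=
      by fun_prop
    obtain ⟨t, ht, htr⟩ := intermediate_value_Icc zero_le_one hcont
      (show min r (dist (γ 0) (γ 1)) ∈ Set.Icc (dist (γ 0) (γ 0)) (dist (γ 0) (γ 1)) by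
        rw [dist_self]
        exact ⟨le_min hr0 dist_nonneg, min_le_right _ _⟩)
    have hsum : dist (γ 0) (γ t) + dist (γ t) (γ 1) ≤ dist (γ 0) (γ 1) + ε := by
      have h1 := eVariationOn.edist_le γ (s := Set.Icc 0 t) (x := 0) (y := t)
        ⟨le_rfl, ht.1⟩ ⟨ht.1, le_rfl⟩
      have h2 := eVariationOn.edist_le γ (s := Set.Icc t 1) (x := t) (y := 1)
        ⟨le_rfl, ht.2⟩ ⟨ht.2, le_rfl⟩
      have h3 := eVariationOn.Icc_add_Icc γ (s := Set.univ) ht.1 ht.2 (Set.mem_univ t)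
      simp only [Set.univ_inter] at h3
      have h4 := ((add_le_add h1 h2).trans h3.le).trans hlen
      rw [edist_dist, edist_dist, ← ENNReal.ofReal_add dist_nonneg dist_nonneg] at h4
      exact (ENNReal.ofReal_le_ofReal_iff (by positivity)).1 h4
    have hyy'' := dist_comm (γ 1) y
    have htri₁ := dist_triangle x (γ 0) (γ t)
    have htri₂ := dist_triangle (γ t) (γ 1) y
    have htri₃ := dist_triangle4 x (γ 0) (γ 1) y
    have htri₄ := dist_triangle4 (γ 0) x y (γ 1)
    have hsymm := dist_comm (γ 0) x
    refine ⟨γ t, ?_, ?_⟩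
    · linarith [min_le_left r (dist (γ 0) (γ 1))]
    · rcases min_choice r (dist (γ 0) (γ 1)) with hm | hm <;> linarith
  let F : Y → ℝ := fun z => max (dist x z - r) (dist z y - (dist x y - r))
  have hF : Continuous F := by fun_prop
  obtain ⟨z, -, hz⟩ := isCompact_univ.exists_isMinOn ⟨x, Set.mem_univ x⟩ hF.continuousOn
  have hFz : F z ≤ 0 := by
    refine le_of_forall_pos_le_add fun ε hε => ?_
    obtain ⟨w, hw₁, hw₂⟩ := approx (ε / 6) (by positivity)
    refine (hz (Set.mem_univ w)).trans (max_le ?_ ?_) <;> linarith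
  have h₁ : dist x z - r ≤ 0 := (le_max_left _ _).trans hFz
  have h₂ : dist z y - (dist x y - r) ≤ 0 := (le_max_right _ _).trans hFz
  have h₃ := dist_triangle x z y
  exact ⟨z, by linarith, by linarith⟩

/-- A set is radially isometric from `p` if the distance to `p` is an isometry on it. -/
def IsRadiallyIsometric {Y : Type*} [MetricSpace Y] (p : Y) (S : Set Y) : Prop :=
  ∀ a ∈ S, ∀ b ∈ S, dist a b = |dist p a - dist p b|

theorem IsRadiallyIsometric.closure {Y : Type*} [MetricSpace Y] {p : Y} {S : Set Y}
    (hS : IsRadiallyIsometric p S) : IsRadiallyIsometric p (closure S) := by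
  intro a ha b hb
  have hmem := map_mem_closure₂ (f := fun a b => (dist a b, |dist p a - dist p b|))
    (u := {q : ℝ × ℝ | q.1 = q.2}) (by fun_prop) ha hb hS
  rwa [(isClosed_eq continuous_fst continuous_snd).closure_eq] at hmem

/-- Adding to a radially isometric set a point that fills a gap between two of its points. -/
theorem IsRadiallyIsometric.insert {Y : Type*} [MetricSpace Y] {p : Y} {S : Set Y}
    (hS : IsRadiallyIsometric p S) (hp : p ∈ S) {a b z : Y} (ha : a ∈ S) (hb : b ∈ S)
    (hgap : ∀ c ∈ S, dist p c ≤ dist p a ∨ dist p b ≤ dist p c)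
    (hab : dist p a ≤ dist p b) {r : ℝ}
    (haz : dist a z = r - dist p a) (hzb : dist z b = dist p b - r) :
    IsRadiallyIsometric p (insert z S) := by
  have har : 0 ≤ r - dist p a := haz ▸ dist_nonneg
  have hrb : 0 ≤ dist p b - r := hzb ▸ dist_nonneg
  have key : ∀ c ∈ S, dist c z = |dist p c - r| := by
    intro c hc
    have hca := hS c hc a ha
    have hcb := hS c hc b hb
    have hac := dist_triangle c a z
    have hbc := dist_triangle c b z
    have hac' := dist_triangle c z a
    have hbc' := dist_triangle c z b
    have := dist_comm a z
    have := dist_comm z b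
    rcases hgap c hc with hle | hle
    · rw [abs_of_nonpos (by linarith)] at hca hcb
      rw [abs_of_nonpos (by linarith)]
      linarith
    · rw [abs_of_nonneg (by linarith)] at hca hcb
      rw [abs_of_nonneg (by linarith)]
      linarith
  have hpz : dist p z = r := by
    rw [key p hp, dist_self, zero_sub, abs_neg, abs_of_nonneg]
    linarith [dist_nonneg (x := p) (y := a)]
  rintro c (rfl | hc) d (rfl | hd)
  · simp
  · rw [dist_comm, key d hd, hpz, abs_sub_comm]
  · rw [key c hc, hpz]
  · exact hS c hc d hd

/-- If distances between points of a compact space can be divided arbitrarily, then any two points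
lie in a set on which the distance to the first is an isometry onto the whole interval. -/
theorem exists_isRadiallyIsometric {Y : Type*} [MetricSpace Y] [CompactSpace Y]
    (hdiv : ∀ (x y : Y) (r : ℝ), 0 ≤ r → r ≤ dist x y →
      ∃ z, dist x z = r ∧ dist z y = dist x y - r) (p q : Y) :
    ∃ S : Set Y, IsRadiallyIsometric p S ∧ q ∈ S ∧
      ∀ r ∈ Set.Icc 0 (dist p q), ∃ z ∈ S, dist p z = r := by
  have hpair : IsRadiallyIsometric p {p, q} := by
    rintro a (rfl | rfl) b (rfl | rfl) <;> simp [dist_comm]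
  obtain ⟨S, hpq, hS⟩ := zorn_subset_nonempty {S : Set Y | IsRadiallyIsometric p S}
    (fun c hc hchain _ => ⟨⋃₀ c, by
      rintro a ⟨s, hs, has⟩ b ⟨t, ht, hbt⟩
      rcases hchain.total hs ht with hst | hts
      · exact hc ht a (hst has) b hbt
      · exact hc hs a has b (hts hbt), fun s hs => Set.subset_sUnion_of_mem hs⟩) _ hpair
  have hp : p ∈ S := hpq (by simp)
  have hq : q ∈ S := hpq (by simp)
  have hcompact : IsCompact S := by
    have hcl : closure S ⊆ S := hS.2 hS.1.closure subset_closure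
    exact (isClosed_of_closure_subset hcl).isCompact
  refine ⟨S, hS.1, hq, fun r hr => ?_⟩
  have hcont : Continuous (dist p) := by fun_prop
  obtain ⟨a, ⟨haS, har⟩, ha⟩ := (hcompact.inter_right
    (isClosed_le hcont continuous_const : IsClosed {z | dist p z ≤ r})).exists_isMaxOn
    ⟨p, hp, by simpa using hr.1⟩ hcont.continuousOn
  obtain ⟨b, ⟨hbS, hbr⟩, hb⟩ := (hcompact.inter_right
    (isClosed_le continuous_const hcont : IsClosed {z | r ≤ dist p z})).exists_isMinOn
    ⟨q, hq, hr.2⟩ hcont.continuousOn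
  rw [Set.mem_ofPred_eq] at har hbr
  have hab : dist a b = dist p b - dist p a := by
    rw [hS.1 a haS b hbS, abs_of_nonpos (by linarith), neg_sub]
  obtain ⟨z, haz, hzb⟩ := hdiv a b (r - dist p a) (by linarith) (by linarith)
  have hgap : ∀ c ∈ S, dist p c ≤ dist p a ∨ dist p b ≤ dist p c := fun c hc =>
    (le_total (dist p c) r).imp (fun hle => ha ⟨hc, hle⟩) (fun hle => hb ⟨hc, hle⟩)
  have hins : IsRadiallyIsometric p (insert z S) :=
    hS.1.insert hp haS hbS hgap (har.trans hbr) haz (by linarith)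
  have hzS : z ∈ S := hS.2 hins (Set.subset_insert z S) (Set.mem_insert z S)
  refine ⟨z, hzS, ?_⟩
  have haz' := hS.1 a haS z hzS
  have hzb' := hS.1 z hzS b hbS
  rcases hgap z hzS with hle | hle
  · rw [abs_of_nonneg (by linarith)] at haz'
    rw [abs_of_nonpos (by linarith)] at hzb'
    linarith
  · rw [abs_of_nonpos (by linarith)] at haz'
    linarith


/-- **Abstract form of Claim 3.4.**
Let `(Y,d)` be a compact metric space and `R ⊆ Y` a dense subset such that any two points
of `R` can be joined, for every `ε > 0`, by a continuous path in `Y` whose length (total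
variation) is at most `d(x,y) + ε`.  Then `(Y,d)` is a geodesic metric space: any two points
`y₁, y₂ ∈ Y` are joined by an isometric path `γ : [0, d(y₁,y₂)] → Y`. -/
theorem degeneration_solitons_path_metric_space
    {Y : Type*} [MetricSpace Y] [CompactSpace Y]
    (R : Set Y) (hR : Dense R)
    (h : ∀ x ∈ R, ∀ y ∈ R, ∀ ε : ℝ, 0 < ε →
      ∃ γ : ℝ → Y, ContinuousOn γ (Set.Icc 0 1) ∧ γ 0 = x ∧ γ 1 = y ∧
        eVariationOn γ (Set.Icc 0 1) ≤ ENNReal.ofReal (dist x y + ε)) :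
    ∀ y₁ y₂ : Y, ∃ γ : ℝ → Y,
      ContinuousOn γ (Set.Icc 0 (dist y₁ y₂)) ∧
      γ 0 = y₁ ∧ γ (dist y₁ y₂) = y₂ ∧
      ∀ s ∈ Set.Icc 0 (dist y₁ y₂), ∀ t ∈ Set.Icc 0 (dist y₁ y₂),
        dist (γ s) (γ t) = |s - t| := by
  intro y₁ y₂
  obtain ⟨S, hS, hy₂, hsurj⟩ := exists_isRadiallyIsometric
    (fun x y r hr0 hr => exists_dist_eq_of_dense_of_paths hR h x y hr0 hr) y₁ y₂
  have : Nonempty Y := ⟨y₁⟩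
  choose! γ hγS hγ using hsurj
  have hdist : ∀ s ∈ Set.Icc 0 (dist y₁ y₂), ∀ t ∈ Set.Icc 0 (dist y₁ y₂),
      dist (γ s) (γ t) = |s - t| := fun s hs t ht => by
    rw [hS _ (hγS s hs) _ (hγS t ht), hγ s hs, hγ t ht]
  refine ⟨γ, ?_, ?_, ?_, hdist⟩
  · refine (LipschitzOnWith.of_dist_le_mul (K := 1) fun s hs t ht => ?_).continuousOn
    rw [hdist s hs t ht, NNReal.coe_one, one_mul, Real.dist_eq]
  · exact (dist_eq_zero.1 (hγ 0 ⟨le_rfl, dist_nonneg⟩)).symm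
  · have hmem : dist y₁ y₂ ∈ Set.Icc 0 (dist y₁ y₂) := ⟨dist_nonneg, le_rfl⟩
    rw [← dist_eq_zero, hS _ (hγS _ hmem) _ hy₂, hγ _ hmem, sub_self, abs_zero]
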